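/- For every positive integer c, every c-cutwidth-minimal semi-complete digraph has at most 24c² + 1 vertices. -/

import Mathlib

open Finset

variable {V : Type*} [Fintype V] [DecidableEq V]

/-- The set of the first `i` vertices in the vertex ordering `π`. -/
def prefixSet (π : V ≃ Fin (Fintype.card V)) (i : ℕ) : Finset V :=
  Finset.univ.filter (fun v => (π v : ℕ) < i)

/-- The set of the last `n - i` vertices in the vertex ordering `π`. -/
def suffixSet (π : V ≃ Fin (Fintype.card V)) (i : ℕ) : Finset V :=
  Finset.univ.filter (fun v => i ≤ (π v : ℕ))

/-- The cut at position `i`: the arcs from outside the length-`i` prefix into the prefix. -/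
def cutFinset (E : V → V → Prop) [DecidableRel E]
    (π : V ≃ Fin (Fintype.card V)) (i : ℕ) : Finset (V × V) :=
  Finset.univ.filter (fun p : V × V => E p.1 p.2 ∧ i ≤ (π p.1 : ℕ) ∧ (π p.2 : ℕ) < i)

/-- The size of the cut at position `i`. -/
def cutSize (E : V → V → Prop) [DecidableRel E]
    (π : V ≃ Fin (Fintype.card V)) (i : ℕ) : ℕ :=
  (cutFinset E π i).card

/-- The width of a vertex ordering. -/
def widthOf (E : V → V → Prop) [DecidableRel E] (π : V ≃ Fin (Fintype.card V)) : ℕ :=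
  (Finset.range (Fintype.card V + 1)).sup (cutSize E π)

/-- The cutwidth of a digraph. -/
noncomputable def cutwidth (E : V → V → Prop) [DecidableRel E] : ℕ :=
  sInf {w | ∃ π : V ≃ Fin (Fintype.card V), widthOf E π = w}

/-- The OLA-cost of a vertex ordering. -/
def olaOf (E : V → V → Prop) [DecidableRel E] (π : V ≃ Fin (Fintype.card V)) : ℕ :=
  ∑ i ∈ Finset.range (Fintype.card V + 1), cutSize E π i

/-- The OLA-cost of a digraph. -/
noncomputable def ola (E : V → V → Prop) [DecidableRel E] : ℕ :=
  sInf {w | ∃ π : V ≃ Fin (Fintype.card V), olaOf E π = w}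

/-- The cutwidth of the subdigraph induced by a set `X` of vertices. -/
noncomputable def cutwidthOn (E : V → V → Prop) [inst : DecidableRel E] (X : Finset V) : ℕ :=
  letI : DecidableRel (fun a b : {x // x ∈ X} => E a.1 b.1) := fun a b => inst a.1 b.1
  cutwidth (fun a b : {x // x ∈ X} => E a.1 b.1)

/-- number of arcs entering `A`. -/
def inCut (E : V → V → Prop) [DecidableRel E]
    (A : Finset V) : ℕ :=
  (Finset.univ.filter (fun p : V × V => E p.1 p.2 ∧ p.1 ∉ A ∧ p.2 ∈ A)).card

/-- number of arcs avoiding `v` that are backward across threshold `t` of `r`. -/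
def delCut (E : V → V → Prop) [DecidableRel E]
    (v : V) (r : V → ℤ) (t : ℤ) : ℕ :=
  (Finset.univ.filter (fun p : V × V => E p.1 p.2 ∧ p.1 ≠ v ∧ p.2 ≠ v ∧ t ≤ r p.1 ∧ r p.2 < t)).card

section aux

lemma inCut_submod (E : V → V → Prop) [DecidableRel E] (A B : Finset V) :
    inCut E (A ∩ B) + inCut E (A ∪ B) ≤ inCut E A + inCut E B := by
  unfold inCut
  rw [Finset.card_filter, Finset.card_filter, Finset.card_filter, Finset.card_filter,
    ← Finset.sum_add_distrib, ← Finset.sum_add_distrib]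
  apply Finset.sum_le_sum
  rintro ⟨x, y⟩ -
  by_cases h : E x y <;> by_cases h1 : x ∈ A <;> by_cases h2 : x ∈ B <;> by_cases h3 : y ∈ A <;>
    by_cases h4 : y ∈ B <;> simp [h, h1, h2, h3, h4]

lemma inCut_empty (E : V → V → Prop) [DecidableRel E] : inCut E ∅ = 0 := by
  simp [inCut]

lemma inCut_univ (E : V → V → Prop) [DecidableRel E] : inCut E Finset.univ = 0 := by
  simp [inCut]

lemma inCut_flip (E : V → V → Prop) [DecidableRel E] (A : Finset V) :
    inCut (fun x y => E y x) Aᶜ = inCut E A := by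
  unfold inCut
  apply Finset.card_bij' (fun p _ => (p.2, p.1)) (fun p _ => (p.2, p.1)) <;> simp <;> tauto

lemma exists_bound (r : V → ℤ) : ∃ M : ℤ, ∀ x, -M < r x ∧ r x < M := by
  refine ⟨∑ x, |r x| + 1, fun x => ?_⟩
  have h := Finset.single_le_sum (f := fun x => |r x|) (fun i _ => abs_nonneg _) (Finset.mem_univ x)
  have h' := abs_le.1 (show |r x| ≤ ∑ x, |r x| from h)
  constructor <;> linarith [h'.1, h'.2]

lemma exists_equiv (R : V → ℤ) (hR : Function.Injective R) :
    ∃ π : V ≃ Fin (Fintype.card V), ∀ x y, π y ≤ π x ↔ R y ≤ R x := by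
  letI : LinearOrder V := LinearOrder.lift' R hR
  refine ⟨(Fintype.orderIsoFinOfCardEq V rfl).symm.toEquiv, fun x y => ?_⟩
  exact (Fintype.orderIsoFinOfCardEq V rfl).symm.le_iff_le

lemma prefix_succ (π : V ≃ Fin (Fintype.card V)) (x : V) :
    prefixSet π (π x + 1) = Finset.univ.filter (fun y => π y ≤ π x) := by
  ext y
  simp only [prefixSet, Finset.mem_filter, Finset.mem_univ, true_and, Fin.le_def]
  omega

lemma prefix_le (E : V → V → Prop) [DecidableRel E] (π : V ≃ Fin (Fintype.card V)) (w : ℕ)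
    (h : ∀ x, inCut E (prefixSet π (π x + 1)) ≤ w) (k : ℕ) : inCut E (prefixSet π k) ≤ w := by
  rcases Nat.eq_zero_or_pos k with rfl | hk
  · have : prefixSet π 0 = ∅ := by ext; simp [prefixSet]
    rw [this, inCut_empty]; omega
  · by_cases hk' : k ≤ Fintype.card V
    · have := h (π.symm ⟨k - 1, by omega⟩)
      simp only [Equiv.apply_symm_apply] at this
      rwa [Nat.sub_add_cancel hk] at this
    · have : prefixSet π k = univ := by
        ext y; simp [prefixSet]; have := (π y).2; omega
      rw [this, inCut_univ]; omega

lemma cutSize_eq (E : V → V → Prop) [DecidableRel E] (π : V ≃ Fin (Fintype.card V)) (k : ℕ) :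
    cutSize E π k = inCut E (prefixSet π k) := by
  unfold cutSize cutFinset inCut prefixSet
  congr 1; ext p; simp

lemma cutwidth_le (E : V → V → Prop) [DecidableRel E] (R : V → ℤ) (hR : Function.Injective R)
    (w : ℕ) (h : ∀ x, inCut E (univ.filter (fun y => R y ≤ R x)) ≤ w) : cutwidth E ≤ w := by
  obtain ⟨π, hπ⟩ := exists_equiv R hR
  have h2 : widthOf E π ≤ w := by
    apply Finset.sup_le
    intro k _
    rw [cutSize_eq]
    apply prefix_le
    intro x
    rw [prefix_succ]
    simpa only [hπ] using h x
  unfold cutwidth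
  exact (Nat.sInf_le (s := {w | ∃ π : V ≃ Fin (Fintype.card V), widthOf E π = w}) ⟨π, rfl⟩).trans h2

lemma exists_del (E : V → V → Prop) [DecidableRel E] (c : ℕ) (v : V)
    (h : cutwidthOn E (univ.erase v) < c) :
    ∃ r : V → ℤ, (∀ x y, x ≠ v → y ≠ v → r x = r y → x = y) ∧ ∀ t, delCut E v r t ≤ c - 1 := by
  unfold cutwidthOn at h
  letI : DecidableRel (fun a b : {x // x ∈ univ.erase v} => E a.1 b.1) :=
    fun a b => (inferInstance : DecidableRel E) a.1 b.1
  have hm := Nat.sInf_mem (s := {w | ∃ π : {x // x ∈ univ.erase v} ≃ Fin (Fintype.card _),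
    widthOf (fun a b : {x // x ∈ univ.erase v} => E a.1 b.1) π = w}) ⟨_, Fintype.equivFin _, rfl⟩
  obtain ⟨π, hπ⟩ := hm
  have hw : widthOf (fun a b : {x // x ∈ univ.erase v} => E a.1 b.1) π < c := by
    rw [hπ]; exact h
  have hcut := prefix_le (fun a b : {x // x ∈ univ.erase v} => E a.1 b.1) π (c - 1) (by
    intro x
    rw [← cutSize_eq]
    have : cutSize (fun a b : {x // x ∈ univ.erase v} => E a.1 b.1) π (π x + 1) ≤ widthOf (fun a b : {x // x ∈ univ.erase v} => E a.1 b.1) π :=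
      Finset.le_sup (f := cutSize _ π) (by have := (π x).2; simp only [Finset.mem_range]; omega)
    omega)
  refine ⟨fun x => if hx : x ∈ univ.erase v then ((π ⟨x, hx⟩ : ℕ) : ℤ) else 0, ?_, ?_⟩
  · intro x y hx hy
    simp only [mem_erase, hx, hy, ne_eq, not_false_eq_true, mem_univ, and_self, dite_true]
    intro hxy
    have : π ⟨x, by simp [hx]⟩ = π ⟨y, by simp [hy]⟩ := by
      apply Fin.ext; exact_mod_cast hxy
    have := π.injective this
    simpa using this
  · intro t
    refine le_trans ?_ (hcut t.toNat)
    unfold delCut inCut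
    refine le_trans (Finset.card_le_card (t := Finset.image (fun p : {x // x ∈ univ.erase v} × {x // x ∈ univ.erase v} => (p.1.1, p.2.1)) (univ.filter _)) ?_) Finset.card_image_le
    rintro ⟨x, y⟩ hp
    simp only [mem_filter, mem_univ, true_and] at hp
    obtain ⟨hE, hx, hy, h1, h2⟩ := hp
    simp only [mem_erase, hx, hy, ne_eq, not_false_eq_true, mem_univ, and_self, dite_true] at h1 h2
    rw [Finset.mem_image]
    refine ⟨(⟨x, by simp [hx]⟩, ⟨y, by simp [hy]⟩), ?_, rfl⟩
    simp only [mem_filter, mem_univ, true_and, prefixSet]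
    refine ⟨hE, ?_, ?_⟩ <;> omega

/-- An ordering which is lean, of bounded width. -/
lemma exists_lean (E : V → V → Prop) [DecidableRel E] (R : V → ℤ) (hR : Function.Injective R)
    (w : ℕ) (h : ∀ x, inCut E (univ.filter (fun y => R y ≤ R x)) ≤ w) :
    ∃ π : V ≃ Fin (Fintype.card V), (∀ k, inCut E (prefixSet π k) ≤ w) ∧
      ∀ a b Q, a ≤ b → prefixSet π a ⊆ Q → Q ⊆ prefixSet π b →
        ∃ k, a ≤ k ∧ k ≤ b ∧ inCut E (prefixSet π k) ≤ inCut E Q := by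
  obtain ⟨π0, hπ0⟩ := exists_equiv R hR
  obtain ⟨π, hπm, hmin⟩ := Finset.exists_min_image
    (univ.filter (fun π : V ≃ Fin (Fintype.card V) => ∀ x, inCut E (prefixSet π (π x + 1)) ≤ w))
    (fun π => ∑ x, inCut E (prefixSet π (π x + 1)))
    ⟨π0, by
      simp only [mem_filter, mem_univ, true_and]
      intro x; rw [prefix_succ]; simpa only [hπ0] using h x⟩
  simp only [mem_filter, mem_univ, true_and] at hπm hmin
  refine ⟨π, prefix_le E π w hπm, ?_⟩
  intro a b Q0 hab ha0 hb0
  by_contra! hcon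
  obtain ⟨Q, hQ, hQmin⟩ := Finset.exists_min_image
    (univ.filter (fun Q : Finset V => prefixSet π a ⊆ Q ∧ Q ⊆ prefixSet π b)) (inCut E)
    ⟨Q0, by simp [ha0, hb0]⟩
  simp only [mem_filter, mem_univ, true_and] at hQ hQmin
  obtain ⟨haQ, hQb⟩ := hQ
  have hQ0 := hQmin Q0 ⟨ha0, hb0⟩
  have hlt : ∀ k, a ≤ k → k ≤ b → inCut E Q < inCut E (prefixSet π k) :=
    fun k h1 h2 => hQ0.trans_lt (hcon k h1 h2)
  let n := Fintype.card V
  let R' : V → ℤ := fun x => if x ∈ Q then ((π x : ℕ) : ℤ) else (π x : ℕ) + n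
  have hin : ∀ x y, ((π x : ℕ) : ℤ) = (π y : ℕ) → x = y := by
    intro x y hxy; apply π.injective; apply Fin.ext; exact_mod_cast hxy
  have hlt' : ∀ x, (π x : ℕ) < n := fun x => (π x).2
  have hR' : Function.Injective R' := by
    intro x y hxy
    have h1 := hlt' x
    have h2 := hlt' y
    apply hin
    simp only [R'] at hxy
    split_ifs at hxy <;> omega
  obtain ⟨π', hπ'⟩ := exists_equiv R' hR'
  have hpin : ∀ x ∈ Q, prefixSet π' (π' x + 1) = Q ∩ prefixSet π (π x + 1) := by
    intro x hx
    rw [prefix_succ]; ext y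
    have h1 := hlt' x
    have h2 := hlt' y
    by_cases hy : y ∈ Q <;> simp [hπ', R', hx, hy, prefixSet] <;> omega
  have hpout : ∀ x, x ∉ Q → prefixSet π' (π' x + 1) = Q ∪ prefixSet π (π x + 1) := by
    intro x hx
    rw [prefix_succ]; ext y
    have h1 := hlt' x
    have h2 := hlt' y
    by_cases hy : y ∈ Q <;> simp [hπ', R', hx, hy, prefixSet] <;> omega
  have hle : ∀ x, inCut E (prefixSet π' (π' x + 1)) ≤ inCut E (prefixSet π (π x + 1)) := by
    intro x
    have hsub := inCut_submod E Q (prefixSet π (π x + 1))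
    by_cases hx : x ∈ Q
    · rw [hpin x hx]
      have := hQmin (Q ∪ prefixSet π (π x + 1)) ⟨haQ.trans subset_union_left, by
        apply union_subset hQb
        have := hQb hx
        intro y; simp [prefixSet] at this ⊢; omega⟩
      omega
    · rw [hpout x hx]
      have := hQmin (Q ∩ prefixSet π (π x + 1)) ⟨by
        apply subset_inter haQ
        have : x ∉ prefixSet π a := fun h => hx (haQ h)
        intro y; simp [prefixSet] at this ⊢; omega, inter_subset_left.trans hQb⟩
      omega
  have hstrict : ∃ x, inCut E (prefixSet π' (π' x + 1)) < inCut E (prefixSet π (π x + 1)) := by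
    have hne : Q ≠ prefixSet π a := by
      rintro rfl; exact lt_irrefl _ (hlt a le_rfl hab)
    obtain ⟨z0, hz0, hz0a⟩ : ∃ z ∈ Q, z ∉ prefixSet π a := by
      by_contra! hh; exact hne (subset_antisymm hh haQ)
    obtain ⟨z, hz, hzmax⟩ := Finset.exists_max_image Q (fun x => (π x : ℕ)) ⟨z0, hz0⟩
    refine ⟨z, ?_⟩
    rw [hpin z hz]
    have h1 : Q ∩ prefixSet π (π z + 1) = Q := by
      apply inter_eq_left.2
      intro y hy
      have := hzmax y hy
      simp [prefixSet]; omega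
    rw [h1]
    apply hlt
    · have := hzmax z0 hz0
      simp [prefixSet] at hz0a; omega
    · have := hQb hz
      simp [prefixSet] at this; omega
  obtain ⟨x0, hx0⟩ := hstrict
  have h1 := hmin π' (fun x => (hle x).trans (hπm x))
  have h2 : ∑ x, inCut E (prefixSet π' (π' x + 1)) < ∑ x, inCut E (prefixSet π (π x + 1)) :=
    Finset.sum_lt_sum (fun x _ => hle x) ⟨x0, mem_univ _, hx0⟩
  omega

lemma key (E : V → V → Prop) [DecidableRel E]
    (hsc : ∀ u v : V, u ≠ v → E u v ∨ E v u) (s w : ℕ)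
    (hdel : ∀ v, ∃ r : V → ℤ, (∀ x y, x ≠ v → y ≠ v → r x = r y → x = y) ∧
      ∀ t, delCut E v r t ≤ s)
    (P B : Finset V) (hPB : P ⊆ B) (hlean : ∀ Q, P ⊆ Q → Q ⊆ B → inCut E P ≤ inCut E Q)
    (hP : inCut E P ≤ w) (hB : inCut E B ≤ w) (hg : 2 * w + 2 * s + 1 ≤ (B \ P).card)
    (hBc : w + 2 ≤ Bᶜ.card) :
    ∃ r : V → ℤ, (∀ x ∈ P, ∀ y ∈ P, r x = r y → x = y) ∧ inCut E P ≤ s ∧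
      ∀ t, inCut E (P.filter (fun y => r y < t)) ≤ s := by
  -- choose a vertex outside with no arc into B
  obtain ⟨v, hv, hvB⟩ : ∃ v ∈ Bᶜ, ∀ y ∈ B, ¬ E v y := by
    by_contra! hh
    have : Bᶜ.card ≤ inCut E B := by
      unfold inCut
      refine le_trans (Finset.card_le_card ?_) (Finset.card_image_le (f := Prod.fst))
      intro x hx
      obtain ⟨y, hy, hxy⟩ := hh x hx
      simp only [mem_image, mem_filter, mem_univ, true_and]
      exact ⟨(x, y), ⟨hxy, by simpa using hx, hy⟩, rfl⟩
    omega
  have hv : v ∉ B := by simpa using hv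
  obtain ⟨r, hinj, hr⟩ := hdel v
  have hsub : ∀ S : Finset V, ∀ t, (∀ x, x ∈ S ↔ x ≠ v ∧ r x < t) → S ⊆ B →
      inCut E (S ∩ P) ≤ s := by
    intro S t hS hSB
    have h1 := inCut_submod E S P
    have h2 := hlean (S ∪ P) subset_union_right (union_subset hSB hPB)
    have h3 : inCut E S ≤ delCut E v r t := by
      apply Finset.card_le_card
      rintro ⟨x, y⟩ hp
      simp only [mem_filter, mem_univ, true_and, hS] at hp ⊢
      obtain ⟨hE, hx, hy, hyt⟩ := hp
      have hxv : x ≠ v := by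
        rintro rfl
        exact hvB y (hSB ((hS y).2 ⟨hy, hyt⟩)) hE
      exact ⟨hE, hxv, hy, by by_contra hh; exact hx ⟨hxv, by omega⟩, hyt⟩
    have := hr t
    omega
  have hclaim : ∀ y ∈ P, ∀ x, x ∉ B → x ≠ v → r y < r x := by
    intro y hy x hx hxv
    by_contra hcon
    have hyB := hPB hy
    have hyv : y ≠ v := by rintro rfl; exact hv hyB
    have hxy : x ≠ y := by rintro rfl; exact hx hyB
    have hne : r x ≠ r y := fun h => hxy (hinj x y hxv hyv h)
    have c1 : (univ.filter (fun z => E z y ∧ z ∉ P)).card ≤ w := by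
      refine le_trans (Finset.card_le_card_of_injOn (fun z => (z, y)) ?_ ?_) hP
      · intro z hz; simp at hz ⊢; exact ⟨hz.1, hz.2, hy⟩
      · intro z _ z' _; simp
    have c2 : (univ.filter (fun z => E x z ∧ z ∈ B)).card ≤ w := by
      refine le_trans (Finset.card_le_card_of_injOn (fun z => (x, z)) ?_ ?_) hB
      · intro z hz; simp at hz ⊢; exact ⟨hz.1, hx, hz.2⟩
      · intro z _ z' _; simp
    have c3 : (univ.filter (fun z => E y z ∧ z ≠ v ∧ r z < r y)).card ≤ s := by
      refine le_trans (Finset.card_le_card_of_injOn (fun z => (y, z)) ?_ ?_) (hr (r y))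
      · intro z hz; simp at hz ⊢; exact ⟨hz.1, hyv, hz.2.1, hz.2.2⟩
      · intro z _ z' _; simp
    have c4 : (univ.filter (fun z => E z x ∧ z ≠ v ∧ r x < r z)).card ≤ s := by
      refine le_trans (Finset.card_le_card_of_injOn (fun z => (z, x)) ?_ ?_) (hr (r x + 1))
      · intro z hz; simp at hz ⊢; exact ⟨hz.1, hz.2.1, hxv, by omega⟩
      · intro z _ z' _; simp
    have hcov : B \ P ⊆ (univ.filter (fun z => E z y ∧ z ∉ P) ∪ univ.filter (fun z => E x z ∧ z ∈ B))
        ∪ (univ.filter (fun z => E y z ∧ z ≠ v ∧ r z < r y) ∪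
          univ.filter (fun z => E z x ∧ z ≠ v ∧ r x < r z)) := by
      intro z hz
      simp only [mem_sdiff] at hz
      have hzv : z ≠ v := by rintro rfl; exact hv hz.1
      have hzy : z ≠ y := by rintro rfl; exact hz.2 hy
      have hzx : z ≠ x := by rintro rfl; exact hx hz.1
      simp only [mem_union, mem_filter, mem_univ, true_and]
      by_cases hzr : r z < r y
      · rcases hsc z y hzy with h | h
        · exact Or.inl (Or.inl ⟨h, hz.2⟩)
        · exact Or.inr (Or.inl ⟨h, hzv, hzr⟩)
      · rcases hsc z x hzx with h | h
        · exact Or.inr (Or.inr ⟨h, hzv, by omega⟩)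
        · exact Or.inl (Or.inr ⟨h, hz.1⟩)
    have e1 := Finset.card_le_card hcov
    have e2 := Finset.card_union_le (univ.filter (fun z => E z y ∧ z ∉ P)) (univ.filter (fun z => E x z ∧ z ∈ B))
    have e3 := Finset.card_union_le (univ.filter (fun z => E y z ∧ z ≠ v ∧ r z < r y)) 
          (univ.filter (fun z => E z x ∧ z ≠ v ∧ r x < r z))
    have e4 := e1.trans (Finset.card_union_le _ _)
    omega
  have hPs : inCut E P ≤ s := by
    have hne : (Bᶜ.erase v).Nonempty := by
      rw [← Finset.card_pos]
      have := Finset.pred_card_le_card_erase (s := Bᶜ) (a := v)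
      omega
    obtain ⟨x, hx, hxmin⟩ := Finset.exists_min_image (Bᶜ.erase v) r hne
    simp only [mem_erase, mem_compl] at hx hxmin
    have := hsub (univ.filter (fun z => z ≠ v ∧ r z < r x)) (r x) (by simp) (by
      intro z hz
      simp only [mem_filter, mem_univ, true_and] at hz
      by_contra hzB
      have := hxmin z ⟨hz.1, hzB⟩
      omega)
    have he : univ.filter (fun z => z ≠ v ∧ r z < r x) ∩ P = P := by
      apply inter_eq_right.2
      intro z hz
      simp only [mem_filter, mem_univ, true_and]
      exact ⟨by rintro rfl; exact hv (hPB hz), hclaim z hz x hx.2 hx.1⟩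
    rwa [he] at this
  refine ⟨r, ?_, hPs, ?_⟩
  · intro x hx y hy
    exact hinj x y (by rintro rfl; exact hv (hPB hx)) (by rintro rfl; exact hv (hPB hy))
  · intro t
    by_cases hS : univ.filter (fun z => z ≠ v ∧ r z < t) ⊆ B
    · have := hsub _ t (by simp) hS
      convert this using 2
      ext z
      simp only [mem_filter, mem_inter, mem_univ, true_and]
      constructor
      · rintro ⟨hz, hzt⟩; exact ⟨⟨by rintro rfl; exact hv (hPB hz), hzt⟩, hz⟩
      · rintro ⟨⟨_, hzt⟩, hz⟩; exact ⟨hz, hzt⟩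
    · obtain ⟨x, hx, hxB⟩ := Finset.not_subset.1 hS
      simp only [mem_filter, mem_univ, true_and] at hx
      have : P.filter (fun y => r y < t) = P := by
        apply Finset.filter_true_of_mem
        intro y hy
        exact (hclaim y hy x hxB hx.1).trans hx.2
      rwa [this]

lemma del_flip (E : V → V → Prop) [DecidableRel E] (s : ℕ)
    (hdel : ∀ v, ∃ r : V → ℤ, (∀ x y, x ≠ v → y ≠ v → r x = r y → x = y) ∧
      ∀ t, delCut E v r t ≤ s) :
    ∀ v, ∃ r : V → ℤ, (∀ x y, x ≠ v → y ≠ v → r x = r y → x = y) ∧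
      ∀ t, delCut (fun x y => E y x) v r t ≤ s := by
  intro v
  obtain ⟨r, h1, h2⟩ := hdel v
  refine ⟨fun x => - r x, fun x y hx hy h => h1 x y hx hy (by simpa using h), fun t => ?_⟩
  refine le_trans ?_ (h2 (1 - t))
  unfold delCut
  refine Finset.card_le_card_of_injOn (fun p => (p.2, p.1)) ?_ ?_
  · rintro ⟨x, y⟩ hp
    simp at hp ⊢
    obtain ⟨a, b, c, d, e⟩ := hp
    exact ⟨a, c, b, by omega, by omega⟩
  · rintro ⟨x, y⟩ _ ⟨x', y'⟩ _; simp; tauto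

lemma exists_start (E : V → V → Prop) [DecidableRel E] (c : ℕ) (hc : 0 < c)
    (hcard : 2 ≤ Fintype.card V)
    (hdel : ∀ v, ∃ r : V → ℤ, (∀ x y, x ≠ v → y ≠ v → r x = r y → x = y) ∧
      ∀ t, delCut E v r t ≤ c - 1) :
    ∃ R : V → ℤ, Function.Injective R ∧
      ∀ x, inCut E (univ.filter (fun y => R y ≤ R x)) ≤ 2 * c - 1 := by
  obtain ⟨w, w', hww⟩ := Fintype.exists_pair_of_one_lt_card (α := V) (by omega)
  obtain ⟨u, hu⟩ : ∃ u, (univ.filter (fun y => E u y ∧ y ≠ u)).card ≤ c := by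
    obtain ⟨r, hi, hr⟩ := hdel w
    obtain ⟨u, hu, humax⟩ := Finset.exists_max_image (univ.erase w) r ⟨w', by simp [hww.symm]⟩
    simp only [mem_erase, mem_univ, and_true] at hu humax
    refine ⟨u, ?_⟩
    have h1 : ((univ.filter (fun y => E u y ∧ y ≠ u)).erase w).card ≤ c - 1 := by
      refine le_trans (Finset.card_le_card_of_injOn (fun z => (u, z)) ?_ ?_) (hr (r u))
      · intro z hz
        simp at hz ⊢
        have h2 := humax z hz.2
        have h3 : r z ≠ r u := fun h => hz.1.2 (hi z u hz.2 hu h)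
        exact ⟨hz.1.1, hu, hz.2, by omega⟩
      · intro z _ z' _; simp
    have h2 := Finset.pred_card_le_card_erase (s := univ.filter (fun y => E u y ∧ y ≠ u)) (a := w)
    omega
  obtain ⟨r, hi, hr⟩ := hdel u
  obtain ⟨M, hM⟩ := exists_bound r
  refine ⟨fun x => if x = u then M else r x, ?_, ?_⟩
  · intro x y hxy
    have h1 := hM x
    have h2 := hM y
    by_cases hx : x = u <;> by_cases hy : y = u <;> simp [hx, hy] at hxy ⊢
    · omega
    · omega
    · exact hi x y hx hy hxy
  · intro x
    by_cases hx : x = u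
    · have : univ.filter (fun y => (if y = u then M else r y) ≤ if x = u then M else r x) = univ := by
        ext y
        have h2 := hM y
        simp [hx]; split_ifs <;> omega
      rw [this, inCut_univ]; omega
    · have h1 : inCut E (univ.filter (fun y => (if y = u then M else r y) ≤ if x = u then M else r x))
          ≤ delCut E u r (r x + 1) + ((univ.filter (fun y => E u y ∧ y ≠ u)).image (fun y => (u, y))).card := by
        unfold inCut delCut
        refine le_trans (Finset.card_le_card ?_) (Finset.card_union_le _ _)
        rintro ⟨p, q⟩ hp
        have h1 := hM x
        simp [hx] at hp ⊢
        obtain ⟨hE, h2, h3⟩ := hp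
        have hq : q ≠ u := by rintro rfl; simp at h3; omega
        by_cases hpu : p = u
        · right; subst hpu; exact ⟨⟨hE, hq⟩, rfl⟩
        · left; simp [hpu, hq] at h2 h3; exact ⟨hE, hpu, hq, by omega, by omega⟩
      have h2 := Finset.card_image_le (s := univ.filter (fun y => E u y ∧ y ≠ u)) (f := fun y => (u, y))
      have h3 := hr (r x + 1)
      refine h1.trans ?_
      omega

lemma card_prefix (π : V ≃ Fin (Fintype.card V)) (k : ℕ) (hk : k ≤ Fintype.card V) :
    (prefixSet π k).card = k := by
  have : prefixSet π k = (univ.filter (fun j : Fin (Fintype.card V) => (j : ℕ) < k)).map π.symm.toEmbedding := by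
    ext y; simp [prefixSet]
  rw [this, card_map, Fin.card_filter_val_lt]
  omega

lemma prefix_mono (π : V ≃ Fin (Fintype.card V)) {k l : ℕ} (hk : k ≤ l) :
    prefixSet π k ⊆ prefixSet π l := by
  intro y; simp [prefixSet]; omega

lemma exists_local_min (F : ℕ → ℕ) (n m w g : ℕ) (hm : m ≤ n) (hF : ∀ k, F k ≤ w) :
    ∃ i ≤ n, i ≤ m + w * (g + 1) ∧ m ≤ i + w * (g + 1) ∧
      ∀ k ≤ n, i ≤ k + g → k ≤ i + g → F i ≤ F k := by
  obtain ⟨i, hi, hmin⟩ := Finset.exists_min_image (range (n + 1))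
    (fun i => F i * (g + 1) + ((i : ℤ) - m).natAbs) ⟨m, by simp; omega⟩
  simp only [Finset.mem_range] at hi hmin
  have h1 := hmin m (by omega)
  have h2 : F m * (g + 1) ≤ w * (g + 1) := Nat.mul_le_mul_right _ (hF m)
  refine ⟨i, by omega, by omega, by omega, ?_⟩
  intro k hk h3 h4
  by_contra hlt
  have h5 := hmin k (by omega)
  have h6 : (F k + 1) * (g + 1) ≤ F i * (g + 1) := Nat.mul_le_mul_right _ (by omega)
  rw [add_mul] at h6
  omega

lemma glue (E : V → V → Prop) [DecidableRel E] (s : ℕ) (P : Finset V) (r r' : V → ℤ)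
    (hr : ∀ x ∈ P, ∀ y ∈ P, r x = r y → x = y)
    (hr' : ∀ x ∈ Pᶜ, ∀ y ∈ Pᶜ, r' x = r' y → x = y)
    (h : ∀ t, inCut E (P.filter (fun y => r y < t)) ≤ s)
    (h' : ∀ t, inCut (fun x y => E y x) (Pᶜ.filter (fun y => r' y < t)) ≤ s) :
    cutwidth E ≤ s := by
  obtain ⟨M, hM⟩ := exists_bound r
  obtain ⟨N, hN⟩ := exists_bound r'
  have hb : ∀ x, r x < M ∧ r' x < N := fun x => ⟨(hM x).2, (hN x).2⟩
  apply cutwidth_le E (fun x => if x ∈ P then r x else M + N - r' x)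
  · intro x y hxy
    have h1 := hb x
    have h2 := hb y
    by_cases hx : x ∈ P <;> by_cases hy : y ∈ P <;> simp [hx, hy] at hxy
    · exact hr x hx y hy hxy
    · omega
    · omega
    · exact hr' x (by simpa using hx) y (by simpa using hy) hxy
  · intro x
    have h1 := hb x
    by_cases hx : x ∈ P
    · convert h (r x + 1) using 2
      ext y
      have h2 := hb y
      by_cases hy : y ∈ P <;> simp [hx, hy] <;> omega
    · rw [← inCut_flip]
      convert h' (r' x) using 2
      ext y
      have h2 := hb y
      by_cases hy : y ∈ P <;> simp [hx, hy] ; omega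

end aux

/-- For every positive integer `c`, every `c`-cutwidth-minimal
semi-complete digraph has at most `24c² + 1` vertices. -/
theorem cutwidth_minimal_semicomplete_size (E : V → V → Prop) [DecidableRel E]
    (hirr : ∀ v : V, ¬ E v v)
    (hsc : ∀ u v : V, u ≠ v → E u v ∨ E v u)
    (c : ℕ) (hc : 0 < c)
    (hmin₁ : c ≤ cutwidth E)
    (hmin₂ : ∀ X : Finset V, X ⊂ Finset.univ → cutwidthOn E X < c) :
    Fintype.card V ≤ 24 * c ^ 2 + 1 := by
  by_contra! hn
  have hdel : ∀ v, ∃ r : V → ℤ, (∀ x y, x ≠ v → y ≠ v → r x = r y → x = y) ∧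
      ∀ t, delCut E v r t ≤ c - 1 :=
    fun v => exists_del E c v (hmin₂ _ (Finset.erase_ssubset (mem_univ v)))
  obtain ⟨R, hR, hRw⟩ := exists_start E c hc (by have := Nat.pow_pos (n := 2) hc; omega) hdel
  obtain ⟨π, hπ, hlean⟩ := exists_lean E R hR (2 * c - 1) hRw
  obtain ⟨i, hin, hi1, hi2, hi3⟩ := exists_local_min (fun k => inCut E (prefixSet π k))
    (Fintype.card V) (Fintype.card V / 2) (2 * c - 1) (6 * c - 3) (by omega) hπ
  have hmul : (2 * c - 1) * (6 * c - 3 + 1) + 10 * c = 12 * c ^ 2 + 2 := by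
    obtain ⟨d, rfl⟩ := Nat.exists_eq_add_of_lt hc
    have e1 : 2 * (0 + d + 1) - 1 = 2 * d + 1 := by omega
    have e2 : 6 * (0 + d + 1) - 3 + 1 = 6 * d + 4 := by omega
    rw [e1, e2]; ring
  set X := (2 * c - 1) * (6 * c - 3 + 1) with hX
  set q := c ^ 2 with hq
  obtain ⟨a, ha⟩ : ∃ a, a + (6 * c - 3) = i := ⟨i - (6 * c - 3), by omega⟩
  have hbn : i + (6 * c - 3) + 2 * c + 1 ≤ Fintype.card V := by omega
  have hle : ∀ Q, prefixSet π a ⊆ Q → Q ⊆ prefixSet π (i + (6 * c - 3)) →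
      inCut E (prefixSet π i) ≤ inCut E Q := by
    intro Q h1 h2
    obtain ⟨k, hk1, hk2, hk3⟩ := hlean a (i + (6 * c - 3)) Q (by omega) h1 h2
    exact (hi3 k (by omega) (by omega) (by omega)).trans hk3
  have hca := card_prefix π a (by omega)
  have hci := card_prefix π i (by omega)
  have hcb := card_prefix π (i + (6 * c - 3)) (by omega)
  have mai : prefixSet π a ⊆ prefixSet π i := prefix_mono π (by omega)
  have mib : prefixSet π i ⊆ prefixSet π (i + (6 * c - 3)) := prefix_mono π (by omega)
  obtain ⟨r, hr, -, hr2⟩ := key E hsc (c - 1) (2 * c - 1) hdel (prefixSet π i)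
    (prefixSet π (i + (6 * c - 3))) mib (fun Q h1 h2 => hle Q (mai.trans h1) h2) (hπ _) (hπ _)
    (by rw [card_sdiff_of_subset mib, hcb, hci]; omega) (by rw [card_compl, hcb]; omega)
  obtain ⟨r', hr', -, hr2'⟩ := key (fun x y => E y x) (fun u v h => hsc v u h.symm) (c - 1)
    (2 * c - 1) (del_flip E _ hdel) (prefixSet π i)ᶜ
    (prefixSet π a)ᶜ (compl_subset_compl.2 mai) (fun Q h1 h2 => by
      rw [inCut_flip, ← compl_compl Q, inCut_flip]
      apply hle
      · rwa [← compl_subset_compl, compl_compl]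
      · refine subset_trans ?_ mib
        rwa [← compl_subset_compl, compl_compl])
    (by rw [inCut_flip]; exact hπ _) (by rw [inCut_flip]; exact hπ _)
    (by rw [compl_sdiff_compl, card_sdiff_of_subset mai, hca, hci]; omega)
    (by rw [compl_compl, hca]; omega)
  have := glue E (c - 1) _ r r' hr hr' hr2 hr2'
  omega
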